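/- arXiv:1906.06561 — 5 statements merged into one kernel-verified Lean document; each statement's English description precedes it below -/
import Mathlib

section
/- The star chromatic number of the Cartesian product C3 □ C5 of a 3-cycle and a 5-cycle equals 6; that is, C3 □ C5 admits a star coloring with 6 colors, and every star coloring of C3 □ C5 uses at least 6 colors. -/
/-- A star coloring of `G` with `k` colors: a proper vertex coloring such that
no path on 4 vertices is bicolored. -/
def IsStarColoring {V : Type*} (G : SimpleGraph V) {k : ℕ} (c : V → Fin k) : Prop :=
  (∀ u v : V, G.Adj u v → c u ≠ c v) ∧
  ¬ ∃ v1 v2 v3 v4 : V,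
      v1 ≠ v2 ∧ v1 ≠ v3 ∧ v1 ≠ v4 ∧ v2 ≠ v3 ∧ v2 ≠ v4 ∧ v3 ≠ v4 ∧
      G.Adj v1 v2 ∧ G.Adj v2 v3 ∧ G.Adj v3 v4 ∧ c v1 = c v3 ∧ c v2 = c v4
/-- Adjacency in `C3 □ C5` is decidable. -/
instance decidableRelBoxProdCycleGraph :
    DecidableRel ((SimpleGraph.cycleGraph 3).boxProd (SimpleGraph.cycleGraph 5)).Adj :=
  fun u v => decidable_of_iff
    ((u.1 - v.1 = 1 ∨ v.1 - u.1 = 1) ∧ u.2 = v.2 ∨ (u.2 - v.2 = 1 ∨ v.2 - u.2 = 1) ∧ u.1 = v.1)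
    (by rw [SimpleGraph.boxProd_adj, SimpleGraph.cycleGraph_adj, SimpleGraph.cycleGraph_adj])

/-- An enumeration of the vertices of `C3 □ C5`, one triangle after the other. -/
def vertexAt (n : ℕ) : Fin 3 × Fin 5 := (Fin.ofNat 3 n, Fin.ofNat 5 (n / 3))

/-- The indices of the neighbors of `vertexAt n`, for `n < 15`. -/
def neighborIndices (n : ℕ) : List ℕ :=
  [3 * (n / 3) + (n + 1) % 3, 3 * (n / 3) + (n + 2) % 3, (n + 3) % 15, (n + 12) % 15]

/-- The colors in `a` make the edge from the last vertex `n` to `p`, or a path on four vertices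
containing `n`, violate the star coloring condition. -/
def lastConflict (a : List ℕ) (n : ℕ) : Bool :=
  (neighborIndices n).any fun p => decide (p < n) &&
    (a.getD p 0 == a.getD n 0 ||
    ((neighborIndices p).any fun q => decide (q < n) && a.getD q 0 == a.getD n 0 &&
      (neighborIndices q).any fun r => decide (r < n) && r != p && a.getD r 0 == a.getD p 0) ||
    ((neighborIndices n).any fun q => decide (q < n) && q != p && a.getD q 0 == a.getD p 0 &&
      (neighborIndices q).any fun r => decide (r < n) && r != p && a.getD r 0 == a.getD n 0))

/-- Search for an extension of the partial coloring `a`, which uses the colors below `m`, by `t`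
vertices, using at most `K` colors and introducing new colors in increasing order. -/
def extendable (K : ℕ) : ℕ → List ℕ → ℕ → Bool
  | 0, _, _ => true
  | t + 1, a, m => (List.range (min (m + 1) K)).any fun x =>
      !lastConflict (a ++ [x]) a.length && extendable K t (a ++ [x]) (max m (x + 1))

theorem adj_vertexAt_of_mem_neighborIndices : ∀ n < 15, ∀ p ∈ neighborIndices n,
    ((SimpleGraph.cycleGraph 3).boxProd (SimpleGraph.cycleGraph 5)).Adj
      (vertexAt n) (vertexAt p) := by
  decide +kernel

theorem vertexAt_ne : ∀ i < 15, ∀ j < 15, i ≠ j → vertexAt i ≠ vertexAt j := by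
  decide +kernel

theorem IsStarColoring.lastConflict_eq_false {k : ℕ} {c : Fin 3 × Fin 5 → Fin k}
    (hc : IsStarColoring ((SimpleGraph.cycleGraph 3).boxProd (SimpleGraph.cycleGraph 5)) c)
    {a : List ℕ} {f : ℕ → Fin k} {n : ℕ} (hn : n < 15)
    (ha : ∀ i ≤ n, c (vertexAt i) = f (a.getD i 0)) : lastConflict a n = false := by
  by_contra h
  have hcol {i j : ℕ} (hi : i ≤ n) (hj : j ≤ n) (hij : a.getD i 0 = a.getD j 0) :
      c (vertexAt i) = c (vertexAt j) := by rw [ha i hi, ha j hj, hij]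
  have hadj {i j : ℕ} (hi : i ≤ n) (hj : j ∈ neighborIndices i) :=
    adj_vertexAt_of_mem_neighborIndices i (by omega) j hj
  have hpath {i j p q : ℕ} (hi : i ≤ n) (hj : j ≤ n) (hp : p ≤ n) (hq : q ≤ n)
      (hne : i ≠ p) (hne' : j ≠ q) (hiq : i ≠ q)
      (hij : ((SimpleGraph.cycleGraph 3).boxProd (SimpleGraph.cycleGraph 5)).Adj
        (vertexAt i) (vertexAt j))
      (hjp : p ∈ neighborIndices j) (hpq : q ∈ neighborIndices p)
      (hip : a.getD i 0 = a.getD p 0) (hjq : a.getD j 0 = a.getD q 0) : False :=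
    hc.2 ⟨_, _, _, _, hij.ne, vertexAt_ne i (by omega) p (by omega) hne,
      vertexAt_ne i (by omega) q (by omega) hiq, (hadj hj hjp).ne,
      vertexAt_ne j (by omega) q (by omega) hne', (hadj hp hpq).ne, hij, hadj hj hjp,
      hadj hp hpq, hcol hi hp hip, hcol hj hq hjq⟩
  simp only [lastConflict, List.any_eq_true, Bool.and_eq_true, Bool.or_eq_true,
    decide_eq_true_eq, beq_iff_eq, bne_iff_ne, Bool.not_eq_false] at h
  obtain ⟨p, hp, hpn, (h | ⟨q, hq, ⟨hqn, hqe⟩, r, hr, ⟨hrn, hrp⟩, hre⟩) |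
    ⟨q, hq, ⟨⟨hqn, hqp⟩, hqe⟩, r, hr, ⟨hrn, hrp⟩, hre⟩⟩ := h
  · exact hc.1 _ _ (hadj le_rfl hp) (hcol le_rfl hpn.le h.symm)
  · exact hpath le_rfl hpn.le hqn.le hrn.le hqn.ne' hrp.symm hrn.ne' (hadj le_rfl hp) hq hr
      hqe.symm hre.symm
  · exact hpath hpn.le le_rfl hqn.le hrn.le hqp.symm hrn.ne' hrp.symm (hadj le_rfl hp).symm hq hr
      hqe.symm hre.symm

theorem IsStarColoring.extendable {k K : ℕ} (hk : k ≤ K) {c : Fin 3 × Fin 5 → Fin k}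
    (hc : IsStarColoring ((SimpleGraph.cycleGraph 3).boxProd (SimpleGraph.cycleGraph 5)) c)
    (t : ℕ) : ∀ (a : List ℕ) (m : ℕ) (f : ℕ → Fin k), a.length + t ≤ 15 →
      Set.InjOn f (Set.Iio m) → (∀ x ∈ a, x < m) →
      (∀ i < a.length, c (vertexAt i) = f (a.getD i 0)) → extendable K t a m = true := by
  induction t with
  | zero => intros; rfl
  | succ t ih =>
    intro a m f hlen hf ham ha
    have key (x : ℕ) (hx : x < m + 1) (g : ℕ → Fin k)
        (hg : Set.InjOn g (Set.Iio (max m (x + 1)))) (hgf : ∀ i < m, g i = f i)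
        (hgx : c (vertexAt a.length) = g x) : _root_.extendable K (t + 1) a m = true := by
      have hcard : max m (x + 1) ≤ k := by
        simpa using Finset.card_le_card_of_injOn (s := Finset.range (max m (x + 1)))
          (t := Finset.univ) g (by simp) (by simpa using hg)
      have hcol : ∀ i ≤ a.length, c (vertexAt i) = g ((a ++ [x]).getD i 0) := by
        intro i hi
        rcases hi.lt_or_eq with hi | rfl
        · rw [ha i hi, List.getD_append _ _ _ _ hi, hgf]
          rw [List.getD_eq_getElem _ _ hi]
          exact ham _ (List.getElem_mem hi)
        · simpa using hgx
      simp only [_root_.extendable, List.any_eq_true, List.mem_range, Bool.and_eq_true,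
        Bool.not_eq_true']
      refine ⟨x, by omega, hc.lastConflict_eq_false (by omega) hcol, ih _ _ g ?_ hg ?_ ?_⟩
      · simp; omega
      · intro y hy
        rcases List.mem_append.1 hy with hy | hy
        · exact lt_max_of_lt_left (ham y hy)
        · simp_all
      · intro i hi
        exact hcol i (by simp at hi; omega)
    by_cases h : ∃ j < m, c (vertexAt a.length) = f j
    · obtain ⟨j, hj, hcj⟩ := h
      exact key j (by omega) f (by rwa [max_eq_left hj]) (fun _ _ => rfl) hcj
    · push Not at h
      have hupd : ∀ i < m, Function.update f m (c (vertexAt a.length)) i = f i :=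
        fun i hi => Function.update_of_ne hi.ne _ _
      refine key m (by omega) (Function.update f m (c (vertexAt a.length))) ?_ hupd (by simp)
      intro i hi j hj hij
      simp only [Set.mem_Iio] at hi hj
      rcases Nat.lt_or_ge i m with him | him <;> rcases Nat.lt_or_ge j m with hjm | hjm
      · rw [hupd i him, hupd j hjm] at hij
        exact hf him hjm hij
      · obtain rfl : j = m := by omega
        simp only [hupd i him, Function.update_self] at hij
        exact absurd hij.symm (h i him)
      · obtain rfl : i = m := by omega
        simp only [hupd j hjm, Function.update_self] at hij
        exact absurd hij (h j hjm)
      · omega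

theorem not_extendable_five : extendable 5 15 [] 0 = false := by
  decide +kernel

/-- A star coloring of `C3 □ C5` with six colors. -/
def sixColoring (v : Fin 3 × Fin 5) : Fin 6 :=
  !![0, 1, 2, 1, 3; 1, 3, 0, 3, 4; 2, 4, 1, 5, 0] v.1 v.2

theorem isStarColoring_sixColoring :
    IsStarColoring ((SimpleGraph.cycleGraph 3).boxProd (SimpleGraph.cycleGraph 5))
      sixColoring := by
  have hpath : ∀ v1 v2, ((SimpleGraph.cycleGraph 3).boxProd (SimpleGraph.cycleGraph 5)).Adj v1 v2 →
      ∀ v3, ((SimpleGraph.cycleGraph 3).boxProd (SimpleGraph.cycleGraph 5)).Adj v2 v3 →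
      v1 ≠ v3 → sixColoring v1 = sixColoring v3 →
      ∀ v4, ((SimpleGraph.cycleGraph 3).boxProd (SimpleGraph.cycleGraph 5)).Adj v3 v4 →
      v2 ≠ v4 → sixColoring v2 ≠ sixColoring v4 := by
    decide +kernel
  refine ⟨by decide +kernel, ?_⟩
  rintro ⟨v1, v2, v3, v4, -, h13, -, -, h24, -, a12, a23, a34, c13, c24⟩
  exact hpath v1 v2 a12 v3 a23 h13 c13 v4 a34 h24 c24

/-- The star chromatic number of `C3 □ C5` equals 6: it admits a star coloring with
6 colors, and every star coloring of it uses at least 6 colors. -/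
theorem starChromatic_C3_C5_eq_six :
    (∃ c : Fin 3 × Fin 5 → Fin 6,
      IsStarColoring ((SimpleGraph.cycleGraph 3).boxProd (SimpleGraph.cycleGraph 5)) c) ∧
    (∀ k : ℕ, (∃ c : Fin 3 × Fin 5 → Fin k,
      IsStarColoring ((SimpleGraph.cycleGraph 3).boxProd (SimpleGraph.cycleGraph 5)) c) →
      6 ≤ k) := by
  refine ⟨⟨sixColoring, isStarColoring_sixColoring⟩, ?_⟩
  rintro k ⟨c, hc⟩
  by_contra! hk
  have h := hc.extendable (Nat.le_of_lt_succ hk) 15 [] 0 (fun _ => c 0)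
    (by simp) (by simp) (by simp) (by simp)
  exact absurd h (by simp [not_extendable_five])
end

section
/- There is no star coloring of the Cartesian product C3 □ C5 of a 3-cycle and a 5-cycle using only 5 colors. -/
namespace IsStarColoring

variable {V : Type*} {G : SimpleGraph V} {k : ℕ} {c : V → Fin k}

/-- Renaming the colors preserves star colorings. -/
theorem comp_perm (h : IsStarColoring G c) (σ : Equiv.Perm (Fin k)) :
    IsStarColoring G (σ ∘ c) := by
  simpa [IsStarColoring] using h

/-- In a star coloring no walk `v₁, v₂, v₃, v₄` without immediate backtracking is bicolored. -/
theorem not_bicolored (h : IsStarColoring G c) {v₁ v₂ v₃ v₄ : V}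
    (h₁₂ : G.Adj v₁ v₂) (h₂₃ : G.Adj v₂ v₃) (h₃₄ : G.Adj v₃ v₄)
    (h₁₃ : v₁ ≠ v₃) (h₂₄ : v₂ ≠ v₄) (hc : c v₁ = c v₃) : c v₂ ≠ c v₄ := by
  intro hc'
  refine h.2 ⟨v₁, v₂, v₃, v₄, h₁₂.ne, h₁₃, ?_, h₂₃.ne, h₂₄, h₃₄.ne, h₁₂, h₂₃, h₃₄, hc, hc'⟩
  rintro rfl
  exact h.1 _ _ h₃₄ hc.symm

end IsStarColoring

namespace TriangleBoxPentagon

/-- The vertices of `C3 □ C5`, numbered column by column. -/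
def vertex (n : ℕ) : Fin 3 × Fin 5 := (Fin.ofNat 3 n, Fin.ofNat 5 (n / 3))

theorem vertex_injOn : ∀ a < 15, ∀ b < 15, vertex a = vertex b → a = b := by
  decide

/-- The Boolean predicate `p` holds at all neighbors of the vertex with number `n`. -/
def allNeighbors (n : ℕ) (p : ℕ → Bool) : Bool :=
  p (n / 3 * 3 + (n + 1) % 3) && (p (n / 3 * 3 + (n + 2) % 3) &&
    (p ((n + 3) % 15) && p ((n + 12) % 15)))

theorem allNeighbors_eq_true {n : ℕ} (hn : n < 15) {p : ℕ → Bool}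
    (hp : ∀ x < 15, ((SimpleGraph.cycleGraph 3).boxProd (SimpleGraph.cycleGraph 5)).Adj
      (vertex n) (vertex x) → p x = true) : allNeighbors n p = true := by
  simp only [SimpleGraph.boxProd_adj, SimpleGraph.cycleGraph_adj] at hp
  simp only [allNeighbors, Bool.and_eq_true]
  refine ⟨hp _ ?_ ?_, hp _ ?_ ?_, hp _ ?_ ?_, hp _ ?_ ?_⟩ <;> clear hp <;> revert n <;> decide

/-- The vertices `a` and `b` have the same color in the partial coloring `f`, where the value `0`
marks uncolored vertices. -/
def sameColor (f : ℕ → ℕ) (a b : ℕ) : Bool :=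
  !(f a).beq 0 && (f a).beq (f b)

/-- The partial coloring `f` of the vertices `0, …, n` violates no star coloring condition on an
edge at `n` or on a path having `n` as its first or second vertex. -/
def validAt (n : ℕ) (f : ℕ → ℕ) : Bool :=
  allNeighbors n fun x => n.ble x || (!sameColor f n x &&
    allNeighbors x fun y => n.ble y || (!sameColor f n y ||
      (allNeighbors y (fun z => x.beq z || !sameColor f x z) &&
        allNeighbors n fun z => x.beq z || !sameColor f x z)))

/-- The partial coloring `f`, with the vertex `n` recolored to `x`. -/
def recolor (f : ℕ → ℕ) (n x : ℕ) : ℕ → ℕ := fun i => cond (i.beq n) x (f i)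

/-- Whether the partial coloring `f` of the vertices below `n` extends, one vertex at a time, to
`m` further vertices. -/
def extendable : ℕ → ℕ → (ℕ → ℕ) → Bool
  | 0, _, _ => true
  | m + 1, n, f => [1, 2, 3, 4, 5].any fun x =>
      validAt n (recolor f n x) && extendable m (n + 1) (recolor f n x)

theorem not_extendable :
    extendable 12 3 (recolor (recolor (recolor (fun _ => 0) 0 1) 1 2) 2 3) = false := by
  decide +kernel

/-- The partial coloring `f` agrees with `c`, up to the shift by one that makes room for the
value `0` of uncolored vertices. -/
def IsPartOf (f : ℕ → ℕ) (c : Fin 3 × Fin 5 → Fin 5) : Prop :=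
  ∀ i, f i ≠ 0 → f i = c (vertex i) + 1

theorem IsPartOf.recolor {f : ℕ → ℕ} {c : Fin 3 × Fin 5 → Fin 5} (h : IsPartOf f c) (n : ℕ) :
    IsPartOf (recolor f n (c (vertex n) + 1)) c := by
  intro i
  by_cases hi : i = n
  · simp [TriangleBoxPentagon.recolor, hi]
  · have hi' : i.beq n = false := by rwa [Bool.eq_false_iff, ne_eq, Nat.beq_eq]
    simpa [TriangleBoxPentagon.recolor, hi'] using h i

theorem IsPartOf.eq_of_sameColor {f : ℕ → ℕ} {c : Fin 3 × Fin 5 → Fin 5} (hf : IsPartOf f c)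
    {a b : ℕ} (h : sameColor f a b = true) : c (vertex a) = c (vertex b) := by
  have ha := hf a
  have hb := hf b
  simp only [sameColor, Bool.and_eq_true, Bool.not_eq_true', Bool.eq_false_iff, ne_eq,
    Nat.beq_eq] at h
  omega

theorem IsPartOf.validAt {f : ℕ → ℕ} {c : Fin 3 × Fin 5 → Fin 5} (hf : IsPartOf f c)
    (hc : IsStarColoring ((SimpleGraph.cycleGraph 3).boxProd (SimpleGraph.cycleGraph 5)) c)
    {n : ℕ} (hn : n < 15) : validAt n f = true := by
  have hne {a b : ℕ} (ha : a < 15) (hb : b < 15) (h : b ≠ a) : vertex a ≠ vertex b :=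
    fun h' => h (vertex_injOn a ha b hb h').symm
  refine allNeighbors_eq_true hn fun x hx hnx => ?_
  simp only [Bool.or_eq_true, Bool.and_eq_true, Bool.not_eq_true', Bool.eq_false_iff]
  refine Or.inr ⟨fun h => hc.1 _ _ hnx (hf.eq_of_sameColor h),
    allNeighbors_eq_true hx fun y hy hxy => ?_⟩
  simp only [Bool.or_eq_true, Bool.and_eq_true, Bool.not_eq_true', Bool.eq_false_iff, Nat.ble_eq,
    or_iff_not_imp_left, not_not, not_le]
  intro hyn h
  have hny := hf.eq_of_sameColor h
  constructor
  · refine allNeighbors_eq_true hy fun z hz hyz => ?_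
    simp only [Bool.or_eq_true, Bool.not_eq_true', Bool.eq_false_iff, Nat.beq_eq,
      or_iff_not_imp_left]
    exact fun hxz h' => hc.not_bicolored hnx hxy hyz (hne hn hy hyn.ne) (hne hx hz (Ne.symm hxz))
      hny (hf.eq_of_sameColor h')
  · refine allNeighbors_eq_true hn fun z hz hnz => ?_
    simp only [Bool.or_eq_true, Bool.not_eq_true', Bool.eq_false_iff, Nat.beq_eq,
      or_iff_not_imp_left]
    exact fun hxz h' => hc.not_bicolored hxy.symm hnx.symm hnz (hne hn hy hyn.ne).symm
      (hne hx hz (Ne.symm hxz)) hny.symm (hf.eq_of_sameColor h')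

theorem IsPartOf.extendable {c : Fin 3 × Fin 5 → Fin 5}
    (hc : IsStarColoring ((SimpleGraph.cycleGraph 3).boxProd (SimpleGraph.cycleGraph 5)) c)
    (m : ℕ) {n : ℕ} (h : n + m ≤ 15) {f : ℕ → ℕ} (hf : IsPartOf f c) :
    extendable m n f = true := by
  induction m generalizing n f with
  | zero => rfl
  | succ m ih =>
    have hx : (c (vertex n) : ℕ) + 1 ∈ [1, 2, 3, 4, 5] := by
      generalize c (vertex n) = x
      revert x
      decide
    exact List.any_eq_true.2 ⟨_, hx, Bool.and_eq_true_iff.2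
      ⟨(hf.recolor n).validAt hc (by omega), ih (by omega) (hf.recolor n)⟩⟩

end TriangleBoxPentagon

/-- Any three distinct colors can be renamed to `0, 1, 2`. -/
theorem exists_perm_map_to_initial {a b c : Fin 5} (hab : a ≠ b) (hac : a ≠ c) (hbc : b ≠ c) :
    ∃ σ : Equiv.Perm (Fin 5), σ a = 0 ∧ σ b = 1 ∧ σ c = 2 := by
  have hinj : Function.Injective ![a, b, c] := by
    intro i j
    fin_cases i <;> fin_cases j <;> simp [*, Ne.symm]
  obtain ⟨σ, hσ⟩ := Equiv.Perm.exists_smul_eq_embedding ⟨_, hinj⟩ (Fin.castLEEmb (by omega : 3 ≤ 5))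
  have hσ := DFunLike.congr_fun hσ
  exact ⟨σ, by simpa using hσ 0, by simpa using hσ 1, by simpa using hσ 2⟩

open TriangleBoxPentagon in
/-- There is no star coloring of `C3 □ C5` using only 5 colors. -/
theorem no_five_star_coloring_C3_C5 :
    ¬ ∃ c : Fin 3 × Fin 5 → Fin 5,
      IsStarColoring ((SimpleGraph.cycleGraph 3).boxProd (SimpleGraph.cycleGraph 5)) c := by
  rintro ⟨c, hc⟩
  have adj : ∀ a < 3, ∀ b < 3, a ≠ b →
      ((SimpleGraph.cycleGraph 3).boxProd (SimpleGraph.cycleGraph 5)).Adj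
        (vertex a) (vertex b) := by
    simp only [SimpleGraph.boxProd_adj, SimpleGraph.cycleGraph_adj]
    decide
  obtain ⟨σ, h0, h1, h2⟩ := exists_perm_map_to_initial
    (hc.1 _ _ (adj 0 (by decide) 1 (by decide) (by decide)))
    (hc.1 _ _ (adj 0 (by decide) 2 (by decide) (by decide)))
    (hc.1 _ _ (adj 1 (by decide) 2 (by decide) (by decide)))
  have hzero : IsPartOf (fun _ => 0) (σ ∘ c) := fun _ h => absurd rfl h
  have hf : IsPartOf (recolor (recolor (recolor (fun _ => 0) 0 1) 1 2) 2 3) (σ ∘ c) := by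
    simpa [h0, h1, h2] using ((hzero.recolor 0).recolor 1).recolor 2
  exact Bool.false_ne_true (not_extendable.symm.trans (hf.extendable (hc.comp_perm σ) 12 le_rfl))
end

section
/- For every natural number m with m ∈ {6, 8, 9, 10} and every natural number n with n ≥ 3, the star chromatic number of the Cartesian product Cm □ Cn equals 5; that is, Cm □ Cn admits a star coloring with 5 colors, and every star coloring of Cm □ Cn uses at least 5 colors. -/
open SimpleGraph

theorem IsStarColoring.not_bicolored_s7 {V : Type*} {G : SimpleGraph V} {k : ℕ} {c : V → Fin k}
    (hc : IsStarColoring G c) {v₁ v₂ v₃ v₄ : V} (h₁₂ : G.Adj v₁ v₂) (h₂₃ : G.Adj v₂ v₃)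
    (h₃₄ : G.Adj v₃ v₄) (h₁₃ : v₁ ≠ v₃) (h₂₄ : v₂ ≠ v₄) : ¬(c v₁ = c v₃ ∧ c v₂ = c v₄) := by
  rintro ⟨h, h'⟩
  refine hc.2 ⟨v₁, v₂, v₃, v₄, h₁₂.ne, h₁₃, ?_, h₂₃.ne, h₂₄, h₃₄.ne, h₁₂, h₂₃, h₃₄, h, h'⟩
  rintro rfl
  exact hc.1 _ _ h₃₄ h.symm

theorem IsStarColoring.comap {V W : Type*} {G : SimpleGraph V} {H : SimpleGraph W} {k l : ℕ}
    {c : W → Fin k} (hc : IsStarColoring H c) {φ : V → W} (hφ : Function.Injective φ)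
    (hadj : ∀ u v, G.Adj u v → H.Adj (φ u) (φ v)) {e : Fin k → Fin l}
    (he : Function.Injective e) : IsStarColoring G (fun v ↦ e (c (φ v))) := by
  refine ⟨fun u v h ↦ he.ne (hc.1 _ _ (hadj _ _ h)), ?_⟩
  rintro ⟨v₁, v₂, v₃, v₄, -, h₁₃, -, -, h₂₄, -, h₁₂, h₂₃, h₃₄, h, h'⟩
  exact hc.not_bicolored_s7 (hadj _ _ h₁₂) (hadj _ _ h₂₃) (hadj _ _ h₃₄) (hφ.ne h₁₃) (hφ.ne h₂₄)
    ⟨he h, he h'⟩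

set_option synthInstance.maxHeartbeats 400000 in
set_option synthInstance.maxSize 2000 in
set_option maxRecDepth 10000 in
theorem not_isStarColoring_pathGraph_four_boxProd_pathGraph_four
    (c : Fin 4 × Fin 4 → Fin 4) : ¬ IsStarColoring ((pathGraph 4).boxProd (pathGraph 4)) c := by
  intro hc
  have key :
      ∀ x00 : Fin 4,
      ∀ x01 : Fin 4, x00 ≠ x01 →
      ∀ x02 : Fin 4, x01 ≠ x02 →
      ∀ x03 : Fin 4, x02 ≠ x03 →
      ∀ x10 : Fin 4, x00 ≠ x10 → ¬(x10 = x01 ∧ x00 = x02) →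
      ∀ x11 : Fin 4, x01 ≠ x11 → x10 ≠ x11 → ¬(x10 = x01 ∧ x00 = x11) →
        ¬(x02 = x11 ∧ x01 = x10) →
      ∀ x12 : Fin 4, x02 ≠ x12 → x11 ≠ x12 → ¬(x00 = x02 ∧ x01 = x12) →
        ¬(x11 = x02 ∧ x01 = x12) → ¬(x00 = x11 ∧ x01 = x12) → ¬(x00 = x11 ∧ x10 = x12) →
        ¬(x10 = x12 ∧ x11 = x02) →
      ∀ x13 : Fin 4, x03 ≠ x13 → x12 ≠ x13 → ¬(x01 = x03 ∧ x02 = x13) →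
        ¬(x12 = x03 ∧ x02 = x13) → ¬(x01 = x12 ∧ x02 = x13) → ¬(x01 = x12 ∧ x11 = x13) →
        ¬(x10 = x12 ∧ x11 = x13) → ¬(x11 = x13 ∧ x12 = x03) →
      ∀ x20 : Fin 4, x10 ≠ x20 → ¬(x01 = x10 ∧ x00 = x20) → ¬(x20 = x11 ∧ x10 = x01) →
      ∀ x21 : Fin 4, x11 ≠ x21 → x20 ≠ x21 → ¬(x00 = x11 ∧ x01 = x21) →
        ¬(x02 = x11 ∧ x01 = x21) → ¬(x00 = x11 ∧ x10 = x21) → ¬(x20 = x11 ∧ x10 = x21) →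
        ¬(x00 = x20 ∧ x10 = x21) → ¬(x21 = x12 ∧ x11 = x02) → ¬(x21 = x12 ∧ x11 = x13) →
        ¬(x01 = x21 ∧ x11 = x20) →
      ∀ x22 : Fin 4, x12 ≠ x22 → x21 ≠ x22 → ¬(x03 = x12 ∧ x02 = x22) →
        ¬(x01 = x12 ∧ x11 = x22) → ¬(x10 = x12 ∧ x11 = x22) → ¬(x21 = x12 ∧ x11 = x22) →
        ¬(x01 = x21 ∧ x11 = x22) → ¬(x10 = x21 ∧ x11 = x22) → ¬(x02 = x22 ∧ x12 = x21) →
        ¬(x13 = x22 ∧ x12 = x21) → ¬(x10 = x21 ∧ x20 = x22) →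
      ∀ x23 : Fin 4, x13 ≠ x23 → x22 ≠ x23 → ¬(x02 = x13 ∧ x03 = x23) →
        ¬(x02 = x13 ∧ x12 = x23) → ¬(x22 = x13 ∧ x12 = x23) → ¬(x02 = x22 ∧ x12 = x23) →
        ¬(x21 = x23 ∧ x22 = x13) →
      ∀ x30 : Fin 4, x20 ≠ x30 → ¬(x00 = x20 ∧ x10 = x30) →
      ∀ x31 : Fin 4, x21 ≠ x31 → x30 ≠ x31 → ¬(x30 = x21 ∧ x20 = x31) →
        ¬(x11 = x31 ∧ x21 = x30) → ¬(x22 = x31 ∧ x21 = x30) →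
      ∀ x32 : Fin 4, x22 ≠ x32 → x31 ≠ x32 → ¬(x02 = x22 ∧ x12 = x32) →
        ¬(x13 = x22 ∧ x12 = x32) → ¬(x31 = x22 ∧ x21 = x32) → ¬(x11 = x31 ∧ x21 = x32) →
        ¬(x32 = x23 ∧ x22 = x13) → ¬(x23 = x32 ∧ x22 = x31) → ¬(x30 = x32 ∧ x31 = x22) →
      ∀ x33 : Fin 4, x23 ≠ x33 → x32 ≠ x33 → ¬(x21 = x23 ∧ x22 = x33) →
        ¬(x32 = x23 ∧ x22 = x33) → ¬(x21 = x32 ∧ x22 = x33) → ¬(x13 = x33 ∧ x23 = x32) →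
        ¬(x21 = x32 ∧ x31 = x33) → ¬(x30 = x32 ∧ x31 = x33) → ¬(x31 = x33 ∧ x32 = x23) →
      False := by
    decide +kernel
  refine key (c (0, 0)) (c (0, 1)) ?_ (c (0, 2)) ?_ (c (0, 3)) ?_ (c (1, 0)) ?_ ?_ (c (1, 1)) ?_ ?_
    ?_ ?_ (c (1, 2)) ?_ ?_ ?_ ?_ ?_ ?_ ?_ (c (1, 3)) ?_ ?_ ?_ ?_ ?_ ?_ ?_ ?_ (c (2, 0)) ?_ ?_ ?_
    (c (2, 1)) ?_ ?_ ?_ ?_ ?_ ?_ ?_ ?_ ?_ ?_ (c (2, 2)) ?_ ?_ ?_ ?_ ?_ ?_ ?_ ?_ ?_ ?_ ?_ (c (2, 3))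
    ?_ ?_ ?_ ?_ ?_ ?_ ?_ (c (3, 0)) ?_ ?_ (c (3, 1)) ?_ ?_ ?_ ?_ ?_ (c (3, 2)) ?_ ?_ ?_ ?_ ?_ ?_ ?_
    ?_ ?_ (c (3, 3)) ?_ ?_ ?_ ?_ ?_ ?_ ?_ ?_ ?_
  all_goals first
    | exact hc.1 _ _ (by simp [pathGraph_adj])
    | exact hc.not_bicolored_s7 (by simp [pathGraph_adj]) (by simp [pathGraph_adj]) (by simp [pathGraph_adj])
        (by decide) (by decide)

set_option synthInstance.maxHeartbeats 400000 in
set_option synthInstance.maxSize 2000 in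
set_option maxRecDepth 10000 in
theorem not_isStarColoring_pathGraph_three_boxProd_cycleGraph_three
    (c : Fin 3 × Fin 3 → Fin 4) : ¬ IsStarColoring ((pathGraph 3).boxProd (cycleGraph 3)) c := by
  intro hc
  have key :
      ∀ x00 : Fin 4,
      ∀ x01 : Fin 4, x00 ≠ x01 →
      ∀ x02 : Fin 4, x00 ≠ x02 → x01 ≠ x02 →
      ∀ x10 : Fin 4, x00 ≠ x10 →
      ∀ x11 : Fin 4, x01 ≠ x11 → x10 ≠ x11 → ¬(x10 = x01 ∧ x00 = x11) →
        ¬(x02 = x10 ∧ x00 = x11) → ¬(x02 = x11 ∧ x01 = x10) →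
      ∀ x12 : Fin 4, x02 ≠ x12 → x10 ≠ x12 → x11 ≠ x12 → ¬(x10 = x02 ∧ x00 = x12) →
        ¬(x01 = x10 ∧ x00 = x12) → ¬(x11 = x02 ∧ x01 = x12) → ¬(x00 = x11 ∧ x01 = x12) →
        ¬(x00 = x12 ∧ x02 = x11) → ¬(x01 = x12 ∧ x02 = x10) →
      ∀ x20 : Fin 4, x10 ≠ x20 →
      ∀ x21 : Fin 4, x11 ≠ x21 → x20 ≠ x21 →
      ∀ x22 : Fin 4, x12 ≠ x22 → x20 ≠ x22 → x21 ≠ x22 →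
      False := by
    decide +kernel
  refine key (c (0, 0)) (c (0, 1)) ?_ (c (0, 2)) ?_ ?_ (c (1, 0)) ?_ (c (1, 1)) ?_ ?_ ?_ ?_ ?_
    (c (1, 2)) ?_ ?_ ?_ ?_ ?_ ?_ ?_ ?_ ?_ (c (2, 0)) ?_ (c (2, 1)) ?_ ?_ (c (2, 2)) ?_ ?_ ?_
  all_goals first
    | exact hc.1 _ _ (by simp [pathGraph_adj, cycleGraph_three_eq_top])
    | exact hc.not_bicolored_s7 (by simp [pathGraph_adj, cycleGraph_three_eq_top])
        (by simp [pathGraph_adj, cycleGraph_three_eq_top])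
        (by simp [pathGraph_adj, cycleGraph_three_eq_top])
        (by decide) (by decide)

theorem pathGraph_adj_castLE {p n : ℕ} (h : p ≤ n) {u v : Fin p}
    (huv : (pathGraph p).Adj u v) : (cycleGraph n).Adj (Fin.castLE h u) (Fin.castLE h v) := by
  apply pathGraph_le_cycleGraph
  simpa [pathGraph_adj] using huv

theorem five_le_of_isStarColoring_cycleGraph_boxProd_cycleGraph {m n k : ℕ} (hm : 4 ≤ m)
    (hn : 3 ≤ n) {c : Fin m × Fin n → Fin k}
    (hc : IsStarColoring ((cycleGraph m).boxProd (cycleGraph n)) c) : 5 ≤ k := by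
  by_contra! hk
  have hk : k ≤ 4 := by omega
  obtain rfl | hn := hn.eq_or_lt
  · refine not_isStarColoring_pathGraph_three_boxProd_cycleGraph_three _ (hc.comap
      (φ := Prod.map (Fin.castLE (by omega : 3 ≤ m)) id)
      ((Fin.castLE_injective _).prodMap Function.injective_id) ?_ (Fin.castLE_injective hk))
    rintro ⟨a, b⟩ ⟨a', b'⟩ h
    simp only [boxProd_adj, Prod.map, id] at h ⊢
    exact h.imp (.imp_left (pathGraph_adj_castLE _)) (.imp_right (congrArg _))
  · refine not_isStarColoring_pathGraph_four_boxProd_pathGraph_four _ (hc.comap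
      (φ := Prod.map (Fin.castLE hm) (Fin.castLE hn))
      ((Fin.castLE_injective _).prodMap (Fin.castLE_injective _)) ?_ (Fin.castLE_injective hk))
    rintro ⟨a, b⟩ ⟨a', b'⟩ h
    simp only [boxProd_adj, Prod.map] at h ⊢
    exact h.imp (.imp (pathGraph_adj_castLE _) (congrArg _))
      (.imp (pathGraph_adj_castLE _) (congrArg _))

theorem cycleGraph_boxProd_cycleGraph_adj {m n : ℕ} {u v : Fin (m + 2) × Fin (n + 2)} :
    ((cycleGraph (m + 2)).boxProd (cycleGraph (n + 2))).Adj u v ↔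
      v = (u.1 + 1, u.2) ∨ v = (u.1 - 1, u.2) ∨ v = (u.1, u.2 + 1) ∨ v = (u.1, u.2 - 1) := by
  obtain ⟨i, j⟩ := u
  obtain ⟨i', j'⟩ := v
  simp only [boxProd_adj, cycleGraph_adj, Prod.mk.injEq, sub_eq_iff_eq_add, eq_sub_iff_add_eq]
  grind

/-- The conditions that four cyclically consecutive rows of a star coloring of a toroidal grid
satisfy: properness, and no bicolored path on four vertices whose middle edge lies in the second
row or joins the second row to the third. -/
def StarWindow {m k : ℕ} [NeZero m] (a b c d : Fin m → Fin k) : Prop :=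
  ∀ i, b i ≠ b (i + 1) ∧ b i ≠ c i ∧
    ¬((b (i - 1) = b (i + 1) ∨ a i = b (i + 1) ∨ c i = b (i + 1)) ∧
      (b i = b (i + 1 + 1) ∨ b i = a (i + 1) ∨ b i = c (i + 1))) ∧
    ¬((a i = c i ∨ b (i - 1) = c i ∨ b (i + 1) = c i) ∧
      (b i = d i ∨ b i = c (i - 1) ∨ b i = c (i + 1)))

instance {m k : ℕ} [NeZero m] (a b c d : Fin m → Fin k) : Decidable (StarWindow a b c d) :=
  inferInstanceAs (Decidable (∀ _, _))

theorem isStarColoring_of_starWindow {m n k : ℕ} {r : Fin (n + 2) → Fin (m + 2) → Fin k}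
    (hr : ∀ j, StarWindow (r j) (r (j + 1)) (r (j + 1 + 1)) (r (j + 1 + 1 + 1))) :
    IsStarColoring ((cycleGraph (m + 2)).boxProd (cycleGraph (n + 2))) fun v ↦ r v.2 v.1 := by
  have hr' (j) : StarWindow (r (j - 1)) (r j) (r (j + 1)) (r (j + 1 + 1)) := by
    simpa using hr (j - 1)
  have horizontal {i j v w}
      (hv : ((cycleGraph (m + 2)).boxProd (cycleGraph (n + 2))).Adj (i, j) v)
      (hw : ((cycleGraph (m + 2)).boxProd (cycleGraph (n + 2))).Adj (i + 1, j) w)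
      (hvi : v ≠ (i + 1, j)) (hwi : w ≠ (i, j)) (h : r v.2 v.1 = r j (i + 1))
      (h' : r j i = r w.2 w.1) : False := by
    rw [cycleGraph_boxProd_cycleGraph_adj] at hv hw
    have := hr' j i |>.2.2.1
    dsimp only at hv hw
    refine this ⟨?_, ?_⟩
    · rcases hv with rfl | rfl | rfl | rfl
      · exact absurd rfl hvi
      · exact .inl h
      · exact .inr (.inr h)
      · exact .inr (.inl h)
    · rcases hw with rfl | rfl | rfl | rfl
      · exact .inl h'
      · simp at hwi
      · exact .inr (.inr h')
      · exact .inr (.inl h')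
  have vertical {i j v w}
      (hv : ((cycleGraph (m + 2)).boxProd (cycleGraph (n + 2))).Adj (i, j) v)
      (hw : ((cycleGraph (m + 2)).boxProd (cycleGraph (n + 2))).Adj (i, j + 1) w)
      (hvi : v ≠ (i, j + 1)) (hwi : w ≠ (i, j)) (h : r v.2 v.1 = r (j + 1) i)
      (h' : r j i = r w.2 w.1) : False := by
    rw [cycleGraph_boxProd_cycleGraph_adj] at hv hw
    have := hr' j i |>.2.2.2
    dsimp only at hv hw
    refine this ⟨?_, ?_⟩
    · rcases hv with rfl | rfl | rfl | rfl
      · exact .inr (.inr h)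
      · exact .inr (.inl h)
      · exact absurd rfl hvi
      · exact .inl h
    · rcases hw with rfl | rfl | rfl | rfl
      · exact .inr (.inr h')
      · exact .inr (.inl h')
      · exact .inl h'
      · simp at hwi
  refine ⟨fun u v huv ↦ ?_, ?_⟩
  · rw [cycleGraph_boxProd_cycleGraph_adj] at huv
    rcases huv with rfl | rfl | rfl | rfl
    · exact (hr' u.2 u.1).1
    · simpa using (hr' u.2 (u.1 - 1)).1.symm
    · exact (hr' u.2 u.1).2.1
    · simpa using (hr' (u.2 - 1) u.1).2.1.symm
  · rintro ⟨v₁, ⟨i, j⟩, v₃, v₄, -, h₁₃, -, -, h₂₄, -, h₁₂, h₂₃, h₃₄, h, h'⟩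
    rcases cycleGraph_boxProd_cycleGraph_adj.1 h₂₃ with rfl | rfl | rfl | rfl
    · exact horizontal h₁₂.symm h₃₄ h₁₃ h₂₄.symm h h'
    · exact horizontal h₃₄ (by simpa using h₁₂.symm) (by simpa using h₂₄.symm) h₁₃
        (by simpa using h'.symm) (by simpa using h.symm)
    · exact vertical h₁₂.symm h₃₄ h₁₃ h₂₄.symm h h'
    · exact vertical h₃₄ (by simpa using h₁₂.symm) (by simpa using h₂₄.symm) h₁₃
        (by simpa using h'.symm) (by simpa using h.symm)

/-- The transitions in cyclic words made of the blocks `0, 1, 2` and `0, 1, 2, 3, 4` and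
`0, 1, 2, 5, 6, 7, 8`, or of the block `9, 10, 11, 12`. -/
def blockSteps : List (Fin 13 × Fin 13) :=
  [(0, 1), (1, 2), (2, 0), (2, 3), (3, 4), (4, 0), (2, 5), (5, 6), (6, 7), (7, 8), (8, 0),
    (9, 10), (10, 11), (11, 12), (12, 9)]

theorem exists_cyclic_blockSteps (n : ℕ) (hn : 1 ≤ n) :
    ∃ s : Fin (n + 2) → Fin 13, ∀ j, (s j, s (j + 1)) ∈ blockSteps := by
  obtain rfl | hn2 := eq_or_ne n 2
  · exact ⟨![9, 10, 11, 12], by decide⟩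
  suffices ∃ w : ℕ → ℕ,
      (∀ l < n + 1, (Fin.ofNat 13 (w l), Fin.ofNat 13 (w (l + 1))) ∈ blockSteps) ∧
      (Fin.ofNat 13 (w (n + 1)), Fin.ofNat 13 (w 0)) ∈ blockSteps by
    obtain ⟨w, hw, hw'⟩ := this
    refine ⟨fun j ↦ Fin.ofNat 13 (w j), fun j ↦ ?_⟩
    dsimp only
    rw [Fin.val_add_one]
    split_ifs with h
    · simpa only [h, Fin.val_last] using hw'
    · exact hw j (by have := Fin.val_lt_last h; omega)
  have step {a b : ℕ} (h : a = 0 ∧ b = 1 ∨ a = 1 ∧ b = 2 ∨ a = 2 ∧ b = 0 ∨ a = 2 ∧ b = 3 ∨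
      a = 3 ∧ b = 4 ∨ a = 4 ∧ b = 0 ∨ a = 2 ∧ b = 5 ∨ a = 5 ∧ b = 6 ∨ a = 6 ∧ b = 7 ∨
      a = 7 ∧ b = 8 ∨ a = 8 ∧ b = 0) : (Fin.ofNat 13 a, Fin.ofNat 13 b) ∈ blockSteps := by
    rcases h with h | h | h | h | h | h | h | h | h | h | h <;> obtain ⟨rfl, rfl⟩ := h <;> decide
  obtain h | h | h : n % 3 = 0 ∨ n % 3 = 1 ∨ n % 3 = 2 := by omega
  · refine ⟨fun l ↦ if l < n then l % 3 else l + 3 - n, fun l hl ↦ step ?_, step ?_⟩ <;> grind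
  · refine ⟨fun l ↦ l % 3, fun l hl ↦ step ?_, step ?_⟩ <;> grind
  · refine ⟨fun l ↦ if l < n - 2 then l % 3 else l + 7 - n, fun l hl ↦ step ?_, step ?_⟩ <;> grind

theorem exists_isStarColoring_of_table {m n k : ℕ} (hn : 3 ≤ n) (T : Fin 13 → Fin (m + 2) → Fin k)
    (hT : ∀ a b, (a, b) ∈ blockSteps → ∀ c, (b, c) ∈ blockSteps → ∀ d, (c, d) ∈ blockSteps →
      StarWindow (T a) (T b) (T c) (T d)) :
    ∃ c : Fin (m + 2) × Fin n → Fin k,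
      IsStarColoring ((cycleGraph (m + 2)).boxProd (cycleGraph n)) c := by
  obtain ⟨n, rfl⟩ := Nat.exists_eq_add_of_le' (show 2 ≤ n by omega)
  obtain ⟨s, hs⟩ := exists_cyclic_blockSteps n (by omega)
  exact ⟨_, isStarColoring_of_starWindow (r := fun j ↦ T (s j)) fun j ↦
    hT _ _ (hs _) _ (hs _) _ (hs _)⟩

set_option synthInstance.maxHeartbeats 400000 in
set_option synthInstance.maxSize 2000 in
/-- For `m ∈ {6, 8, 9, 10}` and `n ≥ 3`, the star chromatic number of `Cm □ Cn`
equals 5. -/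
theorem starChromatic_Cm_Cn_eq_five_of_mem (m n : ℕ)
    (hm : m = 6 ∨ m = 8 ∨ m = 9 ∨ m = 10) (hn : 3 ≤ n) :
    (∃ c : Fin m × Fin n → Fin 5,
      IsStarColoring ((SimpleGraph.cycleGraph m).boxProd (SimpleGraph.cycleGraph n)) c) ∧
    (∀ k : ℕ, (∃ c : Fin m × Fin n → Fin k,
      IsStarColoring ((SimpleGraph.cycleGraph m).boxProd (SimpleGraph.cycleGraph n)) c) →
      5 ≤ k) := by
  refine ⟨?_, fun k ⟨c, hc⟩ ↦
    five_le_of_isStarColoring_cycleGraph_boxProd_cycleGraph (by omega) hn hc⟩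
  obtain rfl | rfl | rfl | rfl := hm
  · exact exists_isStarColoring_of_table hn
      ![![4, 3, 2, 0, 1, 2],
        ![2, 0, 1, 2, 4, 3],
        ![1, 2, 4, 3, 2, 0],
        ![2, 3, 0, 1, 0, 4],
        ![0, 1, 4, 2, 3, 1],
        ![2, 3, 1, 0, 1, 4],
        ![0, 4, 3, 2, 3, 1],
        ![3, 2, 0, 1, 4, 2],
        ![2, 1, 4, 2, 3, 0],
        ![0, 2, 1, 0, 2, 1],
        ![3, 4, 0, 3, 4, 2],
        ![1, 0, 2, 1, 2, 0],
        ![2, 3, 0, 4, 3, 4]]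
      (by decide +kernel)
  · exact exists_isStarColoring_of_table hn
      ![![1, 2, 4, 3, 1, 2, 0, 4],
        ![0, 1, 3, 2, 0, 4, 2, 3],
        ![4, 3, 0, 1, 4, 3, 1, 2],
        ![1, 4, 2, 3, 2, 0, 4, 0],
        ![3, 0, 1, 0, 4, 3, 2, 1],
        ![1, 2, 4, 0, 2, 0, 3, 4],
        ![3, 1, 0, 3, 0, 1, 2, 0],
        ![0, 4, 1, 2, 4, 0, 3, 1],
        ![4, 3, 2, 0, 2, 3, 4, 2],
        ![4, 1, 4, 0, 4, 1, 4, 0],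
        ![3, 4, 2, 4, 3, 4, 2, 4],
        ![4, 0, 4, 1, 4, 0, 4, 1],
        ![2, 4, 3, 4, 2, 4, 3, 4]]
      (by decide +kernel)
  · exact exists_isStarColoring_of_table hn
      ![![2, 0, 1, 4, 3, 2, 0, 1, 3],
        ![1, 2, 3, 0, 1, 4, 3, 2, 4],
        ![3, 4, 0, 2, 0, 3, 1, 4, 0],
        ![2, 0, 1, 3, 4, 2, 0, 3, 1],
        ![4, 3, 2, 0, 2, 1, 4, 0, 2],
        ![2, 0, 1, 4, 3, 2, 0, 3, 1],
        ![0, 3, 4, 0, 1, 4, 2, 1, 4],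
        ![4, 1, 2, 3, 0, 2, 3, 0, 2],
        ![3, 4, 0, 2, 4, 1, 2, 4, 0],
        ![3, 0, 2, 4, 0, 3, 4, 1, 0],
        ![4, 2, 1, 3, 2, 0, 1, 3, 2],
        ![0, 3, 4, 0, 3, 4, 0, 2, 1],
        ![2, 1, 3, 2, 1, 2, 3, 0, 4]]
      (by decide +kernel)
  · exact exists_isStarColoring_of_table hn
      ![![1, 2, 3, 0, 4, 1, 2, 3, 0, 4],
        ![3, 1, 4, 3, 2, 4, 0, 2, 1, 0],
        ![4, 0, 2, 1, 0, 3, 1, 4, 3, 2],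
        ![2, 3, 0, 4, 1, 2, 3, 0, 4, 1],
        ![0, 4, 1, 2, 3, 0, 4, 1, 2, 3],
        ![0, 3, 1, 4, 3, 2, 4, 0, 2, 1],
        ![2, 1, 0, 3, 1, 4, 3, 2, 4, 0],
        ![1, 4, 3, 2, 4, 0, 2, 1, 0, 3],
        ![0, 3, 1, 4, 3, 2, 4, 0, 2, 1],
        ![2, 3, 4, 1, 2, 4, 1, 2, 4, 1],
        ![4, 2, 0, 3, 1, 0, 3, 4, 0, 3],
        ![3, 1, 3, 4, 0, 2, 4, 1, 4, 2],
        ![0, 4, 2, 0, 3, 1, 0, 4, 3, 4]]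
      (by decide +kernel)
end

section
/- For every natural number n with n ≥ 3, the star chromatic number of the Cartesian product C7 □ Cn equals 5; that is, C7 □ Cn admits a star coloring with 5 colors, and every star coloring of C7 □ Cn uses at least 5 colors. -/
namespace StarColoringTorus

/-! ### Backtracking search showing that `C7 □ P3` has no star coloring with 4 colors -/

/-- Extend the partial coloring `l` by `m` further entries, all intermediate lists passing `ok`. -/
def extendable {k : ℕ} (ok : List (Fin k) → Bool) : ℕ → List (Fin k) → Bool
  | 0, _ => true
  | m + 1, l => (List.finRange k).any fun a => ok (l ++ [a]) && extendable ok m (l ++ [a])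

theorem extendable_of_forall_ok {k : ℕ} {ok : List (Fin k) → Bool} (f : ℕ → Fin k) (m p : ℕ)
    (h : ∀ q, p < q → q ≤ p + m → ok ((List.range q).map f) = true) :
    extendable ok m ((List.range p).map f) = true := by
  induction m generalizing p with
  | zero => rfl
  | succ m ih =>
    have hs : (List.range p).map f ++ [f p] = (List.range (p + 1)).map f := by
      simp [List.range_succ]
    simp only [extendable, List.any_eq_true, Bool.and_eq_true]
    refine ⟨f p, List.mem_finRange _, ?_⟩
    rw [hs]
    exact ⟨h _ (by omega) (by omega), ih _ fun q hq hq' => h q (by omega) (by omega)⟩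

/-- Neighbors in `C7 □ P3`, where `3 * i + j` stands for the vertex `(i, j)`. -/
def gridNeighbors (v : ℕ) : List ℕ :=
  (v + 3) % 21 :: (v + 18) % 21 ::
    (if v % 3 = 0 then [v + 1] else if v % 3 = 1 then [v - 1, v + 1] else [v - 1])

/-- Neighbors already colored by a partial coloring of length `p`. -/
def coloredNeighbors (p v : ℕ) : List ℕ := (gridNeighbors v).filter (· < p)

/-- The edge `a b` is properly colored and starts no bicolored path `a b c d`. -/
def edgeOK (l : List (Fin 4)) (a b : ℕ) : Bool :=
  l.getD a 0 != l.getD b 0 &&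
    (coloredNeighbors l.length b).all fun c => a == c || l.getD a 0 != l.getD c 0 ||
      (coloredNeighbors l.length c).all fun d => b == d || l.getD b 0 != l.getD d 0

/-- No edge at the last colored vertex violates the star coloring condition. -/
def lastOK (l : List (Fin 4)) : Bool :=
  (coloredNeighbors l.length (l.length - 1)).all fun b =>
    edgeOK l (l.length - 1) b && edgeOK l b (l.length - 1)

theorem not_extendable_lastOK : extendable lastOK 19 [0, 1] = false := by decide +kernel

theorem gridNeighbors_symm : ∀ a < 21, ∀ b ∈ gridNeighbors a, a ∈ gridNeighbors b := by
  decide +kernel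

theorem gridNeighbors_spec : ∀ a < 21, ∀ b ∈ gridNeighbors a,
    ((SimpleGraph.cycleGraph 7).Adj (Fin.ofNat 7 (a / 3)) (Fin.ofNat 7 (b / 3)) ∧ a % 3 = b % 3) ∨
    ((a % 3 + 1 = b % 3 ∨ b % 3 + 1 = a % 3) ∧ Fin.ofNat 7 (a / 3) = Fin.ofNat 7 (b / 3)) := by
  simp only [SimpleGraph.cycleGraph_adj]
  decide +kernel

theorem no_four_star_coloring_grid_of_normalized (f : ℕ → Fin 4) (hf₀ : f 0 = 0) (hf₁ : f 1 = 1)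
    (hp : ∀ a < 21, ∀ b < 21, b ∈ gridNeighbors a → f a ≠ f b)
    (hs : ∀ a < 21, ∀ b < 21, ∀ c < 21, ∀ d < 21, b ∈ gridNeighbors a → c ∈ gridNeighbors b →
      d ∈ gridNeighbors c → a ≠ c → b ≠ d → f a = f c → f b ≠ f d) : False := by
  have hcol : ∀ q v, v < q → ((List.range q).map f).getD v 0 = f v := by
    intro q v hv
    simp [List.getD, hv]
  have hedge : ∀ q ≤ 21, ∀ a < q, ∀ b < q, b ∈ gridNeighbors a →
      edgeOK ((List.range q).map f) a b = true := by
    intro q hq a ha b hb hab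
    simp only [edgeOK, coloredNeighbors, List.length_map, List.length_range, Bool.and_eq_true,
      Bool.or_eq_true, List.all_eq_true, List.mem_filter, decide_eq_true_eq, bne_iff_ne, beq_iff_eq,
      and_imp]
    rw [hcol q a ha, hcol q b hb]
    refine ⟨hp a (by omega) b (by omega) hab, fun c hbc hc => ?_⟩
    rw [hcol q c hc]
    by_cases hac : a = c
    · exact Or.inl (Or.inl hac)
    by_cases hfac : f a = f c
    · refine Or.inr fun d hcd hd => ?_
      rw [hcol q d hd]
      by_cases hbd : b = d
      · exact Or.inl hbd
      · exact Or.inr (hs a (by omega) b (by omega) c (by omega) d (by omega)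
          hab hbc hcd hac hbd hfac)
    · exact Or.inl (Or.inr hfac)
  have := extendable_of_forall_ok (ok := lastOK) f 19 2 (by
    intro q hq hq'
    simp only [lastOK, coloredNeighbors, List.length_map, List.length_range, Bool.and_eq_true,
      List.all_eq_true, List.mem_filter, decide_eq_true_eq, and_imp]
    intro b hb hbq
    exact ⟨hedge q (by omega) _ (by omega) b hbq hb,
      hedge q (by omega) b hbq _ (by omega) (gridNeighbors_symm _ (by omega) b hb)⟩)
  rw [show (List.range 2).map f = [0, 1] by simp [List.range_succ, hf₀, hf₁],
    not_extendable_lastOK] at this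
  exact Bool.false_ne_true this

theorem exists_perm_zero_one : ∀ x y : Fin 4, x ≠ y →
    ∃ σ : Equiv.Perm (Fin 4), σ x = 0 ∧ σ y = 1 := by
  intro x y hxy
  refine ⟨Equiv.swap (Equiv.swap x 0 y) 1 * Equiv.swap x 0, ?_⟩
  revert x y
  decide

theorem no_four_star_coloring_grid (f : ℕ → Fin 4)
    (hp : ∀ a < 21, ∀ b < 21, b ∈ gridNeighbors a → f a ≠ f b)
    (hs : ∀ a < 21, ∀ b < 21, ∀ c < 21, ∀ d < 21, b ∈ gridNeighbors a → c ∈ gridNeighbors b →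
      d ∈ gridNeighbors c → a ≠ c → b ≠ d → f a = f c → f b ≠ f d) : False := by
  obtain ⟨σ, h₀, h₁⟩ := exists_perm_zero_one (f 0) (f 1)
    (hp 0 (by decide) 1 (by decide) (by decide))
  refine no_four_star_coloring_grid_of_normalized (fun v => σ (f v)) h₀ h₁ ?_ ?_
  · simpa only [ne_eq, σ.injective.eq_iff] using hp
  · simpa only [ne_eq, σ.injective.eq_iff] using hs

theorem cycleGraph_adj_iff_val {n : ℕ} (hn : 3 ≤ n) (u v : Fin n) :
    (SimpleGraph.cycleGraph n).Adj u v ↔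
      (v : ℕ) = (u + 1) % n ∨ (u : ℕ) = (v + 1) % n := by
  obtain ⟨m, rfl⟩ : ∃ m, n = m + 2 := ⟨n - 2, by omega⟩
  rw [SimpleGraph.cycleGraph_adj, or_comm, sub_eq_iff_eq_add', sub_eq_iff_eq_add']
  simp [Fin.ext_iff, Fin.val_add]

theorem five_le_of_isStarColoring {n : ℕ} (hn : 3 ≤ n) {k : ℕ} (c : Fin 7 × Fin n → Fin k)
    (hc : IsStarColoring
      ((SimpleGraph.cycleGraph 7).boxProd (SimpleGraph.cycleGraph n)) c) : 5 ≤ k := by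
  by_contra! hk
  obtain ⟨hproper, hstar⟩ := hc
  let e : ℕ → Fin 7 × Fin n := fun v => (Fin.ofNat 7 (v / 3), ⟨v % 3, by omega⟩)
  have hinj : ∀ a < 21, ∀ b < 21, e a = e b → a = b := by
    intro a ha b hb h
    simp only [e, Prod.mk.injEq, Fin.ext_iff, Fin.val_ofNat] at h
    omega
  have hadj : ∀ a < 21, ∀ b ∈ gridNeighbors a,
      ((SimpleGraph.cycleGraph 7).boxProd (SimpleGraph.cycleGraph n)).Adj (e a) (e b) := by
    intro a ha b hb
    rw [SimpleGraph.boxProd_adj]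
    refine (gridNeighbors_spec a ha b hb).imp (fun h => ⟨h.1, Fin.ext h.2⟩) fun h => ⟨?_, h.2⟩
    rw [cycleGraph_adj_iff_val hn]
    refine h.1.imp (fun h => ?_) fun h => ?_
    · change b % 3 = (a % 3 + 1) % n
      exact h.symm.trans (Nat.mod_eq_of_lt (by omega)).symm
    · change a % 3 = (b % 3 + 1) % n
      exact h.symm.trans (Nat.mod_eq_of_lt (by omega)).symm
  have hcast := Fin.castLE_injective (show k ≤ 4 by omega)
  refine no_four_star_coloring_grid (fun v => Fin.castLE (by omega) (c (e v))) ?_ ?_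
  · exact fun a ha b _ hab h => hproper _ _ (hadj a ha b hab) (hcast h)
  · intro a ha b hb c' hc' d hd hab hbc hcd hac hbd h1 h2
    refine hstar ⟨e a, e b, e c', e d, (hadj a ha b hab).ne, fun h => hac (hinj _ ha _ hc' h), ?_,
      (hadj b hb c' hbc).ne, fun h => hbd (hinj _ hb _ hd h), (hadj c' hc' d hcd).ne,
      hadj a ha b hab, hadj b hb c' hbc, hadj c' hc' d hcd, hcast h1, hcast h2⟩
    intro h
    exact hproper _ _ (hadj a ha b hab) ((congrArg c h).trans (hcast h2).symm)

/-! ### Star colorings with 5 colors from closed walks on a set of columns -/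

/-- Twelve colorings of `C7`: three cyclic blocks, of lengths 3, 4 and 5. -/
def column : Fin 12 → Fin 7 → Fin 5 :=
  ![![1, 3, 0, 4, 1, 2, 0], ![2, 4, 1, 3, 2, 4, 3], ![4, 0, 2, 1, 0, 3, 1],
    ![1, 3, 0, 4, 1, 2, 0], ![2, 1, 4, 2, 3, 1, 4], ![3, 0, 1, 3, 4, 0, 2],
    ![4, 1, 2, 1, 0, 3, 1],
    ![1, 3, 0, 4, 3, 2, 0], ![2, 4, 1, 2, 1, 4, 3], ![0, 2, 3, 4, 3, 0, 1],
    ![3, 1, 0, 3, 2, 4, 2], ![4, 0, 2, 1, 0, 3, 1]]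

/-- The columns that may follow a given column. -/
def followers : Fin 12 → List (Fin 12) :=
  ![[1], [2], [0, 3, 7], [4], [5], [6], [0, 3], [8], [9], [10], [11], [0, 7]]

/-- Adjacency of `(i, z)` and `(j, y)` in the infinite cylinder over `C7`. -/
def CylAdj (i : Fin 7) (z : ℤ) (j : Fin 7) (y : ℤ) : Prop :=
  ((i - j = 1 ∨ j - i = 1) ∧ z = y) ∨ ((y = z + 1 ∨ z = y + 1) ∧ i = j)

/-- Neighbors in the path `P4`. -/
def pathNeighbors : Fin 4 → List (Fin 4) := ![[1], [0, 2], [1, 3], [2]]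

/-- Neighbors in `C7 □ P4`, a window of four consecutive columns of the cylinder. -/
def windowNeighbors (v : Fin 7 × Fin 4) : List (Fin 7 × Fin 4) :=
  (v.1 - 1, v.2) :: (v.1 + 1, v.2) :: (pathNeighbors v.2).map (v.1, ·)

theorem mem_pathNeighbors : ∀ o o' : Fin 4, o'.val = o.val + 1 ∨ o.val = o'.val + 1 →
    o' ∈ pathNeighbors o := by
  decide

/-- The color of a vertex of the window with the four given columns. -/
def windowColor (x₀ x₁ x₂ x₃ : Fin 12) (v : Fin 7 × Fin 4) : Fin 5 :=
  column (![x₀, x₁, x₂, x₃] v.2) v.1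

theorem window_star : ∀ x₀ : Fin 12, ∀ x₁ ∈ followers x₀, ∀ x₂ ∈ followers x₁,
    ∀ x₃ ∈ followers x₂, ∀ v₁, ∀ v₂ ∈ windowNeighbors v₁,
      windowColor x₀ x₁ x₂ x₃ v₁ ≠ windowColor x₀ x₁ x₂ x₃ v₂ ∧
      ∀ v₃ ∈ windowNeighbors v₂,
        windowColor x₀ x₁ x₂ x₃ v₁ = windowColor x₀ x₁ x₂ x₃ v₃ → v₁ ≠ v₃ →
        ∀ v₄ ∈ windowNeighbors v₃,
          windowColor x₀ x₁ x₂ x₃ v₂ = windowColor x₀ x₁ x₂ x₃ v₄ → v₂ = v₄ := by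
  decide +kernel

theorem cylinder_star (W : ℤ → Fin 12) (hW : ∀ z, W (z + 1) ∈ followers (W z))
    {i₁ i₂ i₃ i₄ : Fin 7} {z₁ z₂ z₃ z₄ : ℤ} (h₁₂ : CylAdj i₁ z₁ i₂ z₂) (h₂₃ : CylAdj i₂ z₂ i₃ z₃)
    (h₃₄ : CylAdj i₃ z₃ i₄ z₄) :
    column (W z₁) i₁ ≠ column (W z₂) i₂ ∧
      (column (W z₁) i₁ = column (W z₃) i₃ → ¬ (i₁ = i₃ ∧ z₁ = z₃) →
        column (W z₂) i₂ = column (W z₄) i₄ → i₂ = i₄ ∧ z₂ = z₄) := by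
  obtain ⟨m, hm₁, hm₂, hm₃, hm₄⟩ : ∃ m, (m ≤ z₁ ∧ z₁ < m + 4) ∧ (m ≤ z₂ ∧ z₂ < m + 4) ∧
      (m ≤ z₃ ∧ z₃ < m + 4) ∧ (m ≤ z₄ ∧ z₄ < m + 4) := by
    unfold CylAdj at h₁₂ h₂₃ h₃₄
    exact ⟨min (min z₁ z₂) (min z₃ z₄), by omega, by omega, by omega, by omega⟩
  have lift : ∀ z, m ≤ z ∧ z < m + 4 → ∃ o : Fin 4, z = m + (o : ℕ) := fun z hz =>
    ⟨⟨(z - m).toNat, by omega⟩, by simp only; omega⟩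
  obtain ⟨o₁, rfl⟩ := lift z₁ hm₁
  obtain ⟨o₂, rfl⟩ := lift z₂ hm₂
  obtain ⟨o₃, rfl⟩ := lift z₃ hm₃
  obtain ⟨o₄, rfl⟩ := lift z₄ hm₄
  have hwin : ∀ {i i' : Fin 7} {o o' : Fin 4},
      CylAdj i (m + (o : ℕ)) i' (m + (o' : ℕ)) → (i', o') ∈ windowNeighbors (i, o) := by
    rintro i i' o o' (⟨h, h'⟩ | ⟨h, rfl⟩)
    · obtain rfl : o = o' := by omega
      rcases h with h | h
      · simp [windowNeighbors, ← h]
      · simp [windowNeighbors, ← h]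
    · exact List.mem_cons_of_mem _ (List.mem_cons_of_mem _
        (List.mem_map_of_mem (mem_pathNeighbors o o' (by omega))))
  have hval : ∀ (i : Fin 7) (o : Fin 4), column (W (m + (o : ℕ))) i =
      windowColor (W m) (W (m + 1)) (W (m + 1 + 1)) (W (m + 1 + 1 + 1)) (i, o) := by
    intro i o
    fin_cases o <;> simp [windowColor, add_assoc]
  have key := window_star _ _ (hW m) _ (hW _) _ (hW _) _ _ (hwin h₁₂)
  simp only [hval]
  refine ⟨key.1, fun h hne h' => ?_⟩
  have := key.2 _ (hwin h₂₃) h (fun hh => hne ?_) _ (hwin h₃₄) h'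
  · simpa [Prod.ext_iff, Fin.ext_iff] using this
  · simpa [Prod.ext_iff, Fin.ext_iff] using hh

theorem exists_lift_adj {n : ℕ} (hn : 3 ≤ n) {u v : Fin 7 × Fin n}
    (h : ((SimpleGraph.cycleGraph 7).boxProd (SimpleGraph.cycleGraph n)).Adj u v) {z : ℤ}
    (hz : z % n = (u.2 : ℕ)) : ∃ z' : ℤ, z' % n = (v.2 : ℕ) ∧ CylAdj u.1 z v.1 z' := by
  rw [SimpleGraph.boxProd_adj, SimpleGraph.cycleGraph_adj, cycleGraph_adj_iff_val hn] at h
  rcases h with ⟨h, heq⟩ | ⟨h | h, heq⟩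
  · exact ⟨z, by rw [hz, heq], Or.inl ⟨h, rfl⟩⟩
  · refine ⟨z + 1, ?_, Or.inr ⟨Or.inl rfl, heq⟩⟩
    rw [h, Int.add_emod, hz]
    push_cast
    simp
  · refine ⟨z - 1, ?_, Or.inr ⟨Or.inr (by ring), heq⟩⟩
    rw [h] at hz
    push_cast at hz
    have : (z - 1) % n = ((v.2 : ℕ) : ℤ) % n := by
      have := Int.ModEq.sub_right 1 (show z ≡ (v.2 : ℕ) + 1 [ZMOD n] from by
        simpa [Int.ModEq] using hz)
      simpa [Int.ModEq] using this
    rw [this, Int.emod_eq_of_lt (by omega) (by omega)]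

theorem isStarColoring_of_closed_walk {n : ℕ} (hn : 3 ≤ n) (w : ℕ → Fin 12)
    (hw : ∀ j, j + 1 < n → w (j + 1) ∈ followers (w j)) (hw₀ : w 0 ∈ followers (w (n - 1))) :
    IsStarColoring ((SimpleGraph.cycleGraph 7).boxProd (SimpleGraph.cycleGraph n))
      (fun v => column (w v.2) v.1) := by
  let W : ℤ → Fin 12 := fun z => w (z % n).toNat
  have hW : ∀ z, W (z + 1) ∈ followers (W z) := by
    intro z
    have h₀ := Int.emod_nonneg z (show (n : ℤ) ≠ 0 by omega)
    have h₁ := Int.emod_lt_of_pos z (show (0 : ℤ) < n by omega)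
    have h₂ : (z + 1) % n = (z % n + 1) % n := by simp
    simp only [W, h₂]
    by_cases h : z % n + 1 < n
    · rw [Int.emod_eq_of_lt (by omega) h, Int.toNat_add h₀ (by omega)]
      exact hw _ (by omega)
    · have h₃ : z % n + 1 = n := by omega
      rw [h₃, Int.emod_self, show (z % n).toNat = n - 1 by omega]
      exact hw₀
  have hcol : ∀ (v : Fin 7 × Fin n) (z : ℤ), z % n = (v.2 : ℕ) → w v.2 = W z := by
    intro v z hz
    simp [W, hz]
  have hself : ∀ v : Fin 7 × Fin n, ((v.2 : ℕ) : ℤ) % n = (v.2 : ℕ) := fun v =>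
    Int.emod_eq_of_lt (by omega) (by omega)
  have hne : ∀ {u v : Fin 7 × Fin n} {y z : ℤ}, u ≠ v → y % n = (u.2 : ℕ) → z % n = (v.2 : ℕ) →
      ¬ (u.1 = v.1 ∧ y = z) := by
    rintro u v y z huv hy hz ⟨h, rfl⟩
    exact huv (Prod.ext h (Fin.ext (by omega)))
  constructor
  · intro u v huv
    obtain ⟨z, hz, h⟩ := exists_lift_adj hn huv (hself u)
    obtain ⟨y, hy, h'⟩ := exists_lift_adj hn huv.symm hz
    obtain ⟨x, -, h''⟩ := exists_lift_adj hn huv hy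
    simp only [hcol u _ (hself u), hcol v _ hz]
    exact (cylinder_star W hW h h' h'').1
  · rintro ⟨v₁, v₂, v₃, v₄, -, h₁₃, -, -, h₂₄, -, h₁₂, h₂₃, h₃₄, hcol₁₃, hcol₂₄⟩
    obtain ⟨z₂, hz₂, k₁₂⟩ := exists_lift_adj hn h₁₂ (hself v₁)
    obtain ⟨z₃, hz₃, k₂₃⟩ := exists_lift_adj hn h₂₃ hz₂
    obtain ⟨z₄, hz₄, k₃₄⟩ := exists_lift_adj hn h₃₄ hz₃
    simp only [hcol v₁ _ (hself v₁), hcol v₂ _ hz₂, hcol v₃ _ hz₃, hcol v₄ _ hz₄] at hcol₁₃ hcol₂₄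
    exact hne h₂₄ hz₂ hz₄
      ((cylinder_star W hW k₁₂ k₂₃ k₃₄).2 hcol₁₃ (hne h₁₃ (hself v₁) hz₃) hcol₂₄)

/-- A block of length 3 repeated indefinitely, after the columns `s, …, s + r - 1`. -/
def blockWalk (s r : ℕ) (j : ℕ) : Fin 12 :=
  if j < r then Fin.ofNat 12 (s + j) else Fin.ofNat 12 ((j - r) % 3)

theorem blockWalk_succ_mem {s r : ℕ} (h : (s, r) ∈ [(0, 0), (3, 4), (7, 5)]) (j : ℕ) :
    blockWalk s r (j + 1) ∈ followers (blockWalk s r j) := by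
  have hcycle : ∀ t < 3, Fin.ofNat 12 ((t + 1) % 3) ∈ followers (Fin.ofNat 12 t) := by decide
  by_cases hj : j < r
  · have : ∀ q ∈ [(0, 0), (3, 4), (7, 5)], ∀ j < q.2,
        blockWalk q.1 q.2 (j + 1) ∈ followers (blockWalk q.1 q.2 j) := by decide
    exact this (s, r) h j hj
  · have h₁ : (j + 1 - r) % 3 = ((j - r) % 3 + 1) % 3 := by omega
    simp only [blockWalk, if_neg hj, if_neg (show ¬ j + 1 < r by omega), h₁]
    exact hcycle _ (by omega)

theorem blockWalk_zero_mem {s r : ℕ} (h : (s, r) ∈ [(0, 0), (3, 4), (7, 5)]) {k : ℕ}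
    (hk : 3 ≤ r + 3 * k) : blockWalk s r 0 ∈ followers (blockWalk s r (r + 3 * k - 1)) := by
  rcases k with _ | k
  · simp only [List.mem_cons, Prod.mk.injEq, List.not_mem_nil, or_false] at h
    rcases h with ⟨rfl, rfl⟩ | ⟨rfl, rfl⟩ | ⟨rfl, rfl⟩
    · omega
    · decide
    · decide
  · have h₁ : blockWalk s r (r + 3 * (k + 1) - 1) = 2 := by
      rw [blockWalk, if_neg (by omega), show (r + 3 * (k + 1) - 1 - r) % 3 = 2 by omega]
      rfl
    have h₂ : ∀ q ∈ [(0, 0), (3, 4), (7, 5)], blockWalk q.1 q.2 0 ∈ followers 2 := by decide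
    rw [h₁]
    exact h₂ (s, r) h

theorem exists_five_star_coloring {n : ℕ} (hn : 3 ≤ n) : ∃ c : Fin 7 × Fin n → Fin 5,
    IsStarColoring ((SimpleGraph.cycleGraph 7).boxProd (SimpleGraph.cycleGraph n)) c := by
  obtain ⟨s, r, k, h, rfl⟩ : ∃ s r k, (s, r) ∈ [(0, 0), (3, 4), (7, 5)] ∧ n = r + 3 * k := by
    rcases (by omega : n % 3 = 0 ∨ n % 3 = 1 ∨ n % 3 = 2) with h | h | h
    · exact ⟨0, 0, n / 3, by decide, by omega⟩
    · exact ⟨3, 4, (n - 4) / 3, by decide, by omega⟩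
    · exact ⟨7, 5, (n - 5) / 3, by decide, by omega⟩
  exact ⟨_, isStarColoring_of_closed_walk hn (blockWalk s r)
    (fun j _ => blockWalk_succ_mem h j) (blockWalk_zero_mem h hn)⟩

end StarColoringTorus

/-- For `n ≥ 3`, the star chromatic number of `C7 □ Cn` equals 5. -/
theorem starChromatic_C7_Cn_eq_five (n : ℕ) (hn : 3 ≤ n) :
    (∃ c : Fin 7 × Fin n → Fin 5,
      IsStarColoring ((SimpleGraph.cycleGraph 7).boxProd (SimpleGraph.cycleGraph n)) c) ∧
    (∀ k : ℕ, (∃ c : Fin 7 × Fin n → Fin k,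
      IsStarColoring ((SimpleGraph.cycleGraph 7).boxProd (SimpleGraph.cycleGraph n)) c) →
      5 ≤ k) :=
  ⟨StarColoringTorus.exists_five_star_coloring hn, fun _ ⟨c, hc⟩ =>
    StarColoringTorus.five_le_of_isStarColoring hn c hc⟩
end

section
/- For every natural number n with n ≥ 3, the star chromatic number of the Cartesian product C11 □ Cn equals 5; that is, C11 □ Cn admits a star coloring with 5 colors, and every star coloring of C11 □ Cn uses at least 5 colors. -/
open SimpleGraph

/-! ### Lower bound: four colors do not suffice -/

/-- No edge and no path on four vertices whose largest vertex is `v` is monochromatic, resp.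
bicolored, under the coloring `g` of the graph on `ℕ` with adjacency lists `nb`. -/
def StarAt {k : ℕ} (nb : ℕ → List ℕ) (g : ℕ → Fin k) (v : ℕ) : Prop :=
  (∀ b ∈ nb v, b < v → g b ≠ g v) ∧
  (∀ b ∈ nb v, b < v → ∀ c ∈ nb b, c < v → g c = g v →
    ∀ d ∈ nb c, d < v → d ≠ b → g d ≠ g b) ∧
  (∀ a ∈ nb v, a < v → ∀ c ∈ nb v, c < v → a ≠ c → g a = g c →
    ∀ d ∈ nb c, d < v → d ≠ a → g d ≠ g v)

/-- A Boolean version of `StarAt` that the kernel evaluates quickly. -/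
def starAt {k : ℕ} (nb : ℕ → List ℕ) (g : ℕ → Fin k) (v : ℕ) : Bool :=
  (nb v).all fun b => !b.blt v || (!(g b).val.beq (g v) &&
    ((nb b).all fun c => !(c.blt v && (g c).val.beq (g v)) ||
      (nb c).all fun d => !(d.blt v && !d.beq b && (g d).val.beq (g b))) &&
    ((nb v).all fun c => !(c.blt v && !b.beq c && (g b).val.beq (g c)) ||
      (nb c).all fun d => !(d.blt v && !d.beq b && (g d).val.beq (g v))))

theorem starAt_iff {k : ℕ} {nb : ℕ → List ℕ} {g : ℕ → Fin k} {v : ℕ} :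
    starAt nb g v = true ↔ StarAt nb g v := by
  have blt (a b : ℕ) : a.blt b = decide (a < b) := by
    rw [Bool.eq_iff_iff, Nat.blt_eq, decide_eq_true_iff]
  have beq (a b : ℕ) : a.beq b = decide (a = b) := by
    rw [Bool.eq_iff_iff, Nat.beq_eq, decide_eq_true_iff]
  simp only [starAt, StarAt, blt, beq, List.all_eq_true]
  simp only [Bool.or_eq_true, Bool.and_eq_true, Bool.not_eq_true',
    decide_eq_false_iff_not, List.all_eq_true, Fin.val_inj, Bool.and_eq_false_iff]
  grind

theorem StarAt.congr {k v : ℕ} {nb : ℕ → List ℕ} {f g : ℕ → Fin k}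
    (hfg : ∀ i ≤ v, f i = g i) (h : StarAt nb f v) : StarAt nb g v := by
  obtain ⟨h₁, h₂, h₃⟩ := h
  refine ⟨fun b hb hbv => ?_, fun b hb hbv c hc hcv e d hd hdv hdb => ?_,
    fun a ha hav c hc hcv hac e d hd hdv hda => ?_⟩
  · simpa [hfg, hbv.le] using h₁ b hb hbv
  · simpa [hfg, hbv.le, hdv.le] using
      h₂ b hb hbv c hc hcv (by simpa [hfg, hcv.le] using e) d hd hdv hdb
  · simpa [hfg, hdv.le] using
      h₃ a ha hav c hc hcv hac (by simpa [hfg, hcv.le, hav.le] using e) d hd hdv hda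

/-- Backtracking search: the coloring `g` of the vertices below `v` does not extend to a star
coloring of the vertices below `v + r`. -/
def refutes {k : ℕ} (nb : ℕ → List ℕ) : ℕ → ℕ → (ℕ → Fin k) → Bool
  | 0, _, _ => false
  | r + 1, v, g => (List.finRange k).all fun x =>
      !starAt nb (fun i => if i = v then x else g i) v ||
        refutes nb r (v + 1) (fun i => if i = v then x else g i)

theorem not_forall_starAt_of_refutes {k : ℕ} {nb : ℕ → List ℕ} {f : ℕ → Fin k} {r v : ℕ}
    {g : ℕ → Fin k} (h : refutes nb r v g = true) (hfg : ∀ i < v, g i = f i) :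
    ¬ ∀ i < v + r, StarAt nb f i := by
  induction r generalizing v g with
  | zero => simp [refutes] at h
  | succ r ih =>
    intro hf
    simp only [refutes, List.all_eq_true, List.mem_finRange, true_imp_iff, Bool.or_eq_true,
      Bool.not_eq_true', ← Bool.not_eq_true, starAt_iff, ← imp_iff_not_or] at h
    have agree : ∀ i ≤ v, f i = if i = v then f v else g i := by
      intro i hi
      split_ifs with hiv
      · rw [hiv]
      · exact (hfg i (by omega)).symm
    refine ih (h (f v) ((hf v (by omega)).congr agree)) (fun i hi => (agree i (by omega)).symm) ?_
    intro i hi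
    exact hf i (by omega)

theorem IsStarColoring.starAt {V : Type*} {G : SimpleGraph V} {k : ℕ} {c : V → Fin k}
    (hc : IsStarColoring G c) {nb : ℕ → List ℕ} {N : ℕ} {φ : ℕ → V}
    (hφ : Set.InjOn φ (Set.Iio N))
    (hadj : ∀ u < N, ∀ w ∈ nb u, w < N → G.Adj (φ u) (φ w)) {v : ℕ} (hv : v < N) :
    StarAt nb (c ∘ φ) v := by
  have ne {a b : ℕ} (ha : a < N) (hb : b < N) (hab : a ≠ b) : φ a ≠ φ b :=
    fun h => hab (hφ ha hb h)
  have path {a b d e : ℕ} (ha : a < N) (hb : b < N) (hd : d < N) (he : e < N)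
      (hab : G.Adj (φ a) (φ b)) (hbd : G.Adj (φ b) (φ d)) (hde : G.Adj (φ d) (φ e))
      (had : a ≠ d) (hae : a ≠ e) (hbe : b ≠ e)
      (h₁ : c (φ a) = c (φ d)) (h₂ : c (φ b) = c (φ e)) : False :=
    hc.2 ⟨φ a, φ b, φ d, φ e, hab.ne, ne ha hd had, ne ha he hae, hbd.ne, ne hb he hbe, hde.ne,
      hab, hbd, hde, h₁, h₂⟩
  refine ⟨fun b hb hbv => (hc.1 _ _ (hadj v hv b hb (hbv.trans hv))).symm,
    fun b hb hbv d hd hdv e₁ e he hev heb e₂ => ?_,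
    fun a ha hav d hd hdv had e₁ e he hev hea e₂ => ?_⟩
  all_goals
    have hdN := hdv.trans hv
    have heN := hev.trans hv
  · have hbN := hbv.trans hv
    exact path hv hbN hdN heN (hadj v hv b hb hbN) (hadj b hbN d hd hdN) (hadj d hdN e he heN)
      hdv.ne' hev.ne' heb.symm e₁.symm e₂.symm
  · have haN := hav.trans hv
    exact path haN hv hdN heN (hadj v hv a ha haN).symm (hadj v hv d hd hdN) (hadj d hdN e he heN)
      had hea.symm hev.ne' e₁ e₂.symm

/-- Adjacency lists of the grid with four columns and four rows, numbered row by row. -/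
def gridNeighbors (v : ℕ) : List ℕ :=
  [[1, 4], [0, 2, 5], [1, 3, 6], [2, 7],
   [0, 5, 8], [1, 4, 6, 9], [2, 5, 7, 10], [3, 6, 11],
   [4, 9, 12], [5, 8, 10, 13], [6, 9, 11, 14], [7, 10, 15],
   [8, 13], [9, 12, 14], [10, 13, 15], [11, 14]].getD v []

/-- Adjacency lists of the triangular prism. -/
def prismNeighbors (v : ℕ) : List ℕ :=
  [[1, 2, 3], [0, 2, 4], [0, 1, 5], [0, 4, 5], [1, 3, 5], [2, 3, 4]].getD v []

theorem refutes_grid : refutes gridNeighbors 16 0 (fun _ => (0 : Fin 4)) = true := by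
  decide +kernel

theorem refutes_prism : refutes prismNeighbors 6 0 (fun _ => (0 : Fin 4)) = true := by
  decide +kernel

theorem cycleGraph_adj_of_val_eq_succ {n : ℕ} {i j : Fin n} (h : (j : ℕ) = i + 1) :
    (cycleGraph n).Adj i j := by
  rw [cycleGraph_adj']
  right
  rw [Fin.sub_val_of_le (by rw [Fin.le_def]; omega)]
  omega

theorem cycleGraph_three_adj {i j : Fin 3} (h : i ≠ j) : (cycleGraph 3).Adj i j := by
  rw [cycleGraph_adj']
  revert i j
  decide

theorem not_isStarColoring_four {n : ℕ} (hn : 3 ≤ n) (c : Fin 11 × Fin n → Fin 4) :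
    ¬ IsStarColoring (cycleGraph 11 □ cycleGraph n) c := by
  intro hc
  obtain rfl | hn := hn.eq_or_lt'
  · let φ : ℕ → Fin 11 × Fin 3 := fun v => (Fin.ofNat 11 (v / 3), Fin.ofNat 3 v)
    refine not_forall_starAt_of_refutes refutes_prism (f := c ∘ φ) (by simp) fun v hv =>
      hc.starAt (N := 6) ?_ ?_ (by simpa using hv)
    · intro a ha b hb h
      simp only [φ, Prod.ext_iff, Fin.ext_iff, Fin.ofNat, Set.mem_Iio] at ha hb h
      omega
    · have key : ∀ u < 6, ∀ w ∈ prismNeighbors u,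
          (u / 3 = w / 3 ∧ u % 3 ≠ w % 3) ∨
          ((w / 3 = u / 3 + 1 ∨ u / 3 = w / 3 + 1) ∧ u % 3 = w % 3) := by decide
      intro u hu w hw hwN
      rw [boxProd_adj]
      rcases key u hu w hw with ⟨h₁, h₂⟩ | ⟨h₁ | h₁, h₂⟩
      · exact .inr ⟨cycleGraph_three_adj (by simpa [φ, Fin.ext_iff] using h₂),
          by simp [φ, h₁]⟩
      · exact .inl ⟨cycleGraph_adj_of_val_eq_succ (by simp [φ]; omega),
          by simpa [φ, Fin.ext_iff] using h₂⟩
      · exact .inl ⟨(cycleGraph_adj_of_val_eq_succ (by simp [φ]; omega)).symm,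
          by simpa [φ, Fin.ext_iff] using h₂⟩
  · let φ : ℕ → Fin 11 × Fin n := fun v => (Fin.ofNat 11 (v / 4), ⟨v % 4, by omega⟩)
    refine not_forall_starAt_of_refutes refutes_grid (f := c ∘ φ) (by simp) fun v hv =>
      hc.starAt (N := 16) ?_ ?_ (by simpa using hv)
    · intro a ha b hb h
      simp only [φ, Prod.ext_iff, Fin.ext_iff, Fin.ofNat, Set.mem_Iio] at ha hb h
      omega
    · have key : ∀ u < 16, ∀ w ∈ gridNeighbors u,
          (u / 4 = w / 4 ∧ (w % 4 = u % 4 + 1 ∨ u % 4 = w % 4 + 1)) ∨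
          ((w / 4 = u / 4 + 1 ∨ u / 4 = w / 4 + 1) ∧ u % 4 = w % 4) := by decide
      intro u hu w hw hwN
      rw [boxProd_adj]
      rcases key u hu w hw with ⟨h₁, h₂ | h₂⟩ | ⟨h₁ | h₁, h₂⟩
      · exact .inr ⟨cycleGraph_adj_of_val_eq_succ h₂, by simp [φ, h₁]⟩
      · exact .inr ⟨(cycleGraph_adj_of_val_eq_succ h₂).symm, by simp [φ, h₁]⟩
      · exact .inl ⟨cycleGraph_adj_of_val_eq_succ (by simp [φ]; omega), by simpa [φ] using h₂⟩
      · exact .inl ⟨(cycleGraph_adj_of_val_eq_succ (by simp [φ]; omega)).symm,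
          by simpa [φ] using h₂⟩

/-! ### Upper bound: gluing colored columns -/

/-- Colorings of the eleven-cycle, used as columns. -/
def column : Fin 16 → Fin 11 → Fin 5 :=
  ![![0, 4, 2, 4, 3, 0, 1, 3, 0, 1, 2],
   ![1, 0, 3, 1, 0, 4, 2, 1, 4, 0, 3],
   ![4, 2, 4, 0, 2, 3, 1, 0, 3, 2, 0],
   ![3, 1, 0, 3, 1, 2, 4, 1, 2, 4, 1],
   ![3, 0, 1, 3, 4, 0, 3, 2, 4, 0, 1],
   ![2, 3, 4, 0, 1, 2, 4, 1, 2, 3, 4],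
   ![0, 3, 1, 4, 3, 0, 4, 2, 0, 4, 1],
   ![2, 4, 0, 2, 4, 1, 3, 0, 1, 3, 0],
   ![3, 1, 3, 0, 1, 2, 0, 4, 2, 0, 4],
   ![0, 3, 1, 4, 3, 0, 4, 2, 0, 4, 1],
   ![2, 4, 0, 2, 4, 1, 2, 3, 1, 2, 3],
   ![1, 0, 3, 1, 0, 3, 0, 2, 4, 0, 2],
   ![3, 1, 4, 0, 2, 1, 4, 1, 2, 3, 4],
   ![2, 0, 1, 2, 1, 3, 0, 2, 4, 3, 1],
   ![4, 1, 3, 1, 4, 0, 1, 3, 1, 2, 0],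
   ![3, 2, 4, 0, 3, 2, 4, 1, 0, 1, 4]]

/-- `Follows a b`: the column `b` may be placed to the right of the column `a`. The closed walks
of this relation are concatenations of `0, 1, 2, 3`, of `0, 1, 2, 4, 5`, of `0, 1, 2, 6, 7, 8` and of
`0, 1, 2, 9, 10, 11, 12`, or repeat `13, 14, 15`. -/
def Follows (a b : Fin 16) : Prop :=
  ((b : ℕ) = a + 1 ∧ (a : ℕ) ∉ [3, 5, 8, 12]) ∨ ((a : ℕ) = 2 ∧ (b : ℕ) ∈ [4, 6, 9]) ∨
    ((a : ℕ) ∈ [3, 5, 8, 12] ∧ (b : ℕ) = 0) ∨ ((a : ℕ) = 15 ∧ (b : ℕ) = 13)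

instance : DecidableRel Follows := fun a b => by
  unfold Follows
  infer_instance

/-- In four consecutive columns `a, b, c, d`, the edges leaving the vertex in row `i` of `b` upwards
or to the right are properly colored and not in the middle of a bicolored path on four vertices. -/
def GoodAt (a b c d : Fin 16) (i : Fin 11) : Prop :=
  column b i ≠ column b (i + 1) ∧ column b i ≠ column c i ∧
  ¬ ((column b (i - 1) = column b (i + 1) ∨ column a i = column b (i + 1) ∨
        column c i = column b (i + 1)) ∧
      (column b i = column b (i + 2) ∨ column b i = column a (i + 1) ∨
        column b i = column c (i + 1))) ∧
  ¬ ((column b (i + 1) = column c i ∨ column b (i - 1) = column c i ∨ column a i = column c i) ∧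
      (column b i = column d i ∨ column b i = column c (i + 1) ∨ column b i = column c (i - 1)))

instance (a b c d : Fin 16) (i : Fin 11) : Decidable (GoodAt a b c d i) := by
  unfold GoodAt
  infer_instance

theorem goodAt_of_follows : ∀ a b, Follows a b → ∀ c, Follows b c → ∀ d, Follows c d →
    ∀ i, GoodAt a b c d i := by
  decide +kernel

theorem exists_closed_walk (m : ℕ) :
    ∃ s : Fin (m + 3) → Fin 16, ∀ j, Follows (s j) (s (j + 1)) := by
  obtain rfl | hm := Nat.eq_zero_or_pos m
  · exact ⟨![13, 14, 15], by decide⟩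
  obtain ⟨q, r, t, hr, ht⟩ : ∃ q r t : ℕ, m + 3 = 4 * q + 4 + r ∧
      ((r = 0 ∧ t = 0) ∨ (r = 1 ∧ t = 1) ∨ (r = 2 ∧ t = 3) ∨ (r = 3 ∧ t = 6)) := by
    have : (m + 3) % 4 < 4 := Nat.mod_lt _ (by norm_num)
    have h : m + 3 = 4 * ((m - 1) / 4) + 4 + (m + 3) % 4 := by omega
    generalize (m + 3) % 4 = r at this h
    interval_cases r
    exacts [⟨_, 0, 0, h, by simp⟩, ⟨_, 1, 1, h, by simp⟩, ⟨_, 2, 3, h, by simp⟩,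
      ⟨_, 3, 6, h, by simp⟩]
  let w : ℕ → ℕ := fun j => if j < 3 then j else if j < 4 + r then j + t else (j - r) % 4
  have hw (j : ℕ) : w j < 16 := by
    simp only [w]
    split_ifs <;> omega
  refine ⟨fun j => ⟨w j, hw j⟩, fun j => ?_⟩
  have hj := j.isLt
  simp only [Follows, Fin.val_add_one, Fin.ext_iff, Fin.val_last, List.mem_cons, List.not_mem_nil,
    or_false, w]
  split_ifs <;> omega

theorem cycleGraph_adj_imp {m : ℕ} {i j : Fin (m + 3)} (h : (cycleGraph (m + 3)).Adj i j) :
    j = i + 1 ∨ j = i - 1 := by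
  rw [cycleGraph_adj] at h
  rcases h with h | h
  · right
    rw [← h]
    abel
  · left
    rw [← h]
    abel

theorem torus_adj_imp {l m : ℕ} {u v : Fin (l + 3) × Fin (m + 3)}
    (h : (cycleGraph (l + 3) □ cycleGraph (m + 3)).Adj u v) :
    (v = (u.1 + 1, u.2) ∨ v = (u.1, u.2 + 1)) ∨ (v = (u.1 - 1, u.2) ∨ v = (u.1, u.2 - 1)) := by
  obtain ⟨i, j⟩ := u
  obtain ⟨i', j'⟩ := v
  rw [boxProd_adj] at h
  rcases h with ⟨h, e⟩ | ⟨h, e⟩ <;> rcases cycleGraph_adj_imp h with h | h <;> simp_all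

theorem isStarColoring_of_follows {m : ℕ} {s : Fin (m + 3) → Fin 16}
    (hs : ∀ j, Follows (s j) (s (j + 1))) :
    IsStarColoring (cycleGraph 11 □ cycleGraph (m + 3)) (fun v => column (s v.2) v.1) := by
  have good (i : Fin 11) (j : Fin (m + 3)) :
      GoodAt (s (j - 1)) (s j) (s (j + 1)) (s (j + 1 + 1)) i :=
    goodAt_of_follows _ _ (by simpa using hs (j - 1)) _ (hs _) _ (hs _) i
  have forward {v₁ v₂ v₃ v₄ : Fin 11 × Fin (m + 3)}
      (h₂ : v₃ = (v₂.1 + 1, v₂.2) ∨ v₃ = (v₂.1, v₂.2 + 1))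
      (h₁ : (cycleGraph 11 □ cycleGraph (m + 3)).Adj v₂ v₁)
      (h₃ : (cycleGraph 11 □ cycleGraph (m + 3)).Adj v₃ v₄)
      (n₁₃ : v₁ ≠ v₃) (n₂₄ : v₂ ≠ v₄)
      (e₁₃ : column (s v₁.2) v₁.1 = column (s v₃.2) v₃.1)
      (e₂₄ : column (s v₂.2) v₂.1 = column (s v₄.2) v₄.1) : False := by
    obtain ⟨i, j⟩ := v₂
    obtain ⟨-, -, up, right⟩ := good i j
    have two : i + 1 + 1 = i + 2 := by rw [add_assoc]; rfl
    rcases h₂ with rfl | rfl <;>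
    rcases torus_adj_imp (l := 8) h₁ with (rfl | rfl) | (rfl | rfl) <;>
    rcases torus_adj_imp (l := 8) h₃ with (rfl | rfl) | (rfl | rfl) <;>
    simp_all
  have proper {u v : Fin 11 × Fin (m + 3)} (h : v = (u.1 + 1, u.2) ∨ v = (u.1, u.2 + 1)) :
      column (s u.2) u.1 ≠ column (s v.2) v.1 := by
    obtain ⟨h₁, h₂, -⟩ := good u.1 u.2
    rcases h with rfl | rfl
    exacts [h₁, h₂]
  have orient {u v : Fin 11 × Fin (m + 3)} (h : (cycleGraph 11 □ cycleGraph (m + 3)).Adj u v) :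
      (v = (u.1 + 1, u.2) ∨ v = (u.1, u.2 + 1)) ∨ (u = (v.1 + 1, v.2) ∨ u = (v.1, v.2 + 1)) :=
    (torus_adj_imp (l := 8) h).imp_right (by rintro (rfl | rfl) <;> simp)
  refine ⟨fun u v h => (orient h).elim proper fun h => (proper h).symm, ?_⟩
  rintro ⟨v₁, v₂, v₃, v₄, -, n₁₃, -, -, n₂₄, -, h₁, h₂, h₃, e₁₃, e₂₄⟩
  rcases orient h₂ with h | h
  · exact forward h h₁.symm h₃ n₁₃ n₂₄ e₁₃ e₂₄
  · exact forward h h₃ h₁.symm n₂₄.symm n₁₃.symm e₂₄.symm e₁₃.symm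

theorem IsStarColoring.castLE {V : Type*} {G : SimpleGraph V} {k l : ℕ} {c : V → Fin k}
    (hc : IsStarColoring G c) (hkl : k ≤ l) : IsStarColoring G (fun v => Fin.castLE hkl (c v)) := by
  simpa [IsStarColoring] using hc

/-- For `n ≥ 3`, the star chromatic number of `C11 □ Cn` equals 5. -/
theorem starChromatic_C11_Cn_eq_five (n : ℕ) (hn : 3 ≤ n) :
    (∃ c : Fin 11 × Fin n → Fin 5,
      IsStarColoring ((SimpleGraph.cycleGraph 11).boxProd (SimpleGraph.cycleGraph n)) c) ∧
    (∀ k : ℕ, (∃ c : Fin 11 × Fin n → Fin k,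
      IsStarColoring ((SimpleGraph.cycleGraph 11).boxProd (SimpleGraph.cycleGraph n)) c) →
      5 ≤ k) := by
  constructor
  · obtain ⟨m, rfl⟩ := Nat.exists_eq_add_of_le' hn
    obtain ⟨s, hs⟩ := exists_closed_walk m
    exact ⟨_, isStarColoring_of_follows hs⟩
  · rintro k ⟨c, hc⟩
    by_contra! hk
    exact not_isStarColoring_four hn _ (hc.castLE (Nat.le_of_lt_succ hk))
end
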